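/- Let μ be an n-dimensional measure on ℝ^m and φ(y) = 1 + ∫_{|y| < |t|} |t|^{-n} dμ(t). Then φ ∈ RBMO(μ): there exists C > 0 and, for each cube Q, a constant φ_Q := φ(y_Q) with |y_Q| = |x_Q| + ℓ(Q)/2, such that (1/μ(5Q)) ∫_Q |φ − φ_Q| dμ ≤ C for all cubes Q, and |φ_Q − φ_R| ≤ C·K(Q,R) for all cubes Q ⊂ R. -/

import Mathlib

open MeasureTheory Metric Set

/-- The closed axis-parallel cube in `ℝ^m` (sup-norm) with center `x` and side length `ℓ`. -/
noncomputable def cube {m : ℕ} (x : Fin m → ℝ) (ℓ : ℝ) : Set (Fin m → ℝ) :=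
  Metric.closedBall x (ℓ / 2)

/-- `μ` is an `n`-dimensional measure with constant `C₀`:
`μ(Q) ≤ C₀ ℓ(Q)^n` for every cube `Q` of positive side length. -/
def IsNDim {m : ℕ} (μ : Measure (Fin m → ℝ)) (n C₀ : ℝ) : Prop :=
  ∀ (x : Fin m → ℝ) (ℓ : ℝ), 0 < ℓ → μ (cube x ℓ) ≤ ENNReal.ofReal (C₀ * ℓ ^ n)

/-- `N_{Q,R}`: the minimal integer `k` with `2^k ℓ(Q) ≥ ℓ(R)`. -/
noncomputable def NQR (ℓQ ℓR : ℝ) : ℕ := ⌈Real.logb 2 (ℓR / ℓQ)⌉₊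

/-- Tolsa's coefficient `K(Q,R) = 1 + ∑_{j=1}^{N_{Q,R}} μ(2^j Q)/ℓ(2^j Q)^n`
for cubes `Q ⊆ R`, where `Q` has center `x` and side `ℓQ`, and `R` has side `ℓR`. -/
noncomputable def Kcoef {m : ℕ} (μ : Measure (Fin m → ℝ)) (n : ℝ)
    (x : Fin m → ℝ) (ℓQ ℓR : ℝ) : ℝ :=
  1 + ∑ j ∈ Finset.Icc 1 (NQR ℓQ ℓR),
    (μ (cube x ((2 : ℝ) ^ j * ℓQ))).toReal / (((2 : ℝ) ^ j * ℓQ) ^ n)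

/-- The test function `φ(y) = 1 + ∫_{|y| < |t|} |t|^{-n} dμ(t)`. -/
noncomputable def phi {m : ℕ} (μ : Measure (Fin m → ℝ)) (n : ℝ) (y : Fin m → ℝ) : ℝ :=
  1 + (∫⁻ t in {t : Fin m → ℝ | ‖y‖ < ‖t‖}, ENNReal.ofReal (‖t‖ ^ (-n)) ∂μ).toReal

/-- A cube of center `x` and side `ℓ` is `(α, β)`-doubling: `μ(αQ) < β μ(Q)`. -/
def Doubling {m : ℕ} (μ : Measure (Fin m → ℝ)) (α β : ℝ)
    (x : Fin m → ℝ) (ℓ : ℝ) : Prop :=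
  μ (cube x (α * ℓ)) < ENNReal.ofReal β * μ (cube x ℓ)


/-- The integral of `|t|^{-n}` over the annulus `a < |t| ≤ b`. -/
noncomputable def annI {m : ℕ} (μ : Measure (Fin m → ℝ)) (n a b : ℝ) : ENNReal :=
  ∫⁻ t in {t : Fin m → ℝ | a < ‖t‖ ∧ ‖t‖ ≤ b}, ENNReal.ofReal (‖t‖ ^ (-n)) ∂μ

lemma ball_bound {m : ℕ} {n C₀ : ℝ} {μ : Measure (Fin m → ℝ)} (hμ : IsNDim μ n C₀)
    (x : Fin m → ℝ) {r : ℝ} (hr : 0 < r) :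
    μ (closedBall x r) ≤ ENNReal.ofReal (C₀ * (2 * r) ^ n) := by
  have h := hμ x (2 * r) (by linarith)
  unfold cube at h
  rwa [show 2 * r / 2 = r by ring] at h

lemma zero_null {m : ℕ} {n C₀ : ℝ} (hn : 0 < n) {μ : Measure (Fin m → ℝ)}
    (hμ : IsNDim μ n C₀) : μ {0} = 0 := by
  have h1 : ∀ r : ℝ, r ∈ Ioi (0:ℝ) → μ {0} ≤ ENNReal.ofReal (C₀ * (2 * r) ^ n) := fun r hr =>
    (measure_mono (by simpa using (le_of_lt hr))).trans (ball_bound hμ 0 hr)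
  have h2 : Filter.Tendsto (fun r : ℝ => ENNReal.ofReal (C₀ * (2 * r) ^ n))
      (nhdsWithin 0 (Ioi 0)) (nhds 0) := by
    have : Continuous (fun r : ℝ => ENNReal.ofReal (C₀ * (2 * r) ^ n)) := by
      apply ENNReal.continuous_ofReal.comp
      exact continuous_const.mul
        ((continuous_const.mul continuous_id).rpow_const (fun _ => Or.inr hn.le))
    have h := this.tendsto 0
    simp only [mul_zero, Real.zero_rpow hn.ne', ENNReal.ofReal_zero] at h
    exact h.mono_left nhdsWithin_le_nhds
  have h3 := ge_of_tendsto h2 (Filter.eventually_of_mem self_mem_nhdsWithin h1)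
  exact le_antisymm h3 (zero_le)

lemma phi_diff {m : ℕ} {n : ℝ} (hn : 0 < n) (μ : Measure (Fin m → ℝ)) [IsFiniteMeasure μ]
    {z y : Fin m → ℝ} (hz : 0 < ‖z‖) (hzy : ‖z‖ ≤ ‖y‖) :
    ENNReal.ofReal |phi μ n z - phi μ n y| = annI μ n ‖z‖ ‖y‖ := by
  have fin : ∀ a : ℝ, 0 < a →
      (∫⁻ t in {t : Fin m → ℝ | a < ‖t‖}, ENNReal.ofReal (‖t‖ ^ (-n)) ∂μ) ≠ ⊤ := by
    intro a ha
    apply ne_of_lt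
    refine lt_of_le_of_lt (b := ∫⁻ t in {t : Fin m → ℝ | a < ‖t‖}, ENNReal.ofReal (a ^ (-n)) ∂μ)
      (setLIntegral_mono measurable_const ?_) ?_
    · intro t ht
      exact ENNReal.ofReal_le_ofReal
        (Real.rpow_le_rpow_of_nonpos ha (le_of_lt ht) (by linarith))
    · rw [setLIntegral_const]
      exact ENNReal.mul_lt_top ENNReal.ofReal_lt_top (measure_lt_top _ _)
  have hsplit : (∫⁻ t in {t : Fin m → ℝ | ‖z‖ < ‖t‖}, ENNReal.ofReal (‖t‖ ^ (-n)) ∂μ) =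
      annI μ n ‖z‖ ‖y‖ +
      (∫⁻ t in {t : Fin m → ℝ | ‖y‖ < ‖t‖}, ENNReal.ofReal (‖t‖ ^ (-n)) ∂μ) := by
    unfold annI
    rw [← lintegral_union]
    · congr 2
      ext t
      simp only [mem_setOf_eq, mem_union]
      constructor
      · intro h
        rcases le_or_gt ‖t‖ ‖y‖ with h' | h'
        · exact Or.inl ⟨h, h'⟩
        · exact Or.inr h'
      · rintro (h | h)
        · exact h.1
        · exact lt_of_le_of_lt hzy h
    · exact measurableSet_lt measurable_const measurable_norm
    · rw [Set.disjoint_left]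
      rintro t ⟨_, h⟩ h'
      exact absurd h (not_le.mpr h')
  have f1 := fin _ hz
  have f2 := fin _ (hz.trans_le hzy)
  have f3 : annI μ n ‖z‖ ‖y‖ ≠ ⊤ := by
    intro h
    rw [hsplit, h] at f1
    simp at f1
  unfold phi
  rw [hsplit, ENNReal.toReal_add f3 f2]
  rw [show ∀ p q : ℝ, 1 + (p + q) - (1 + q) = p by intros; ring,
    abs_of_nonneg ENNReal.toReal_nonneg, ENNReal.ofReal_toReal f3]

lemma annI_bound {m : ℕ} {n C₀ : ℝ} (hn : 0 < n) (hC₀ : 0 < C₀) {μ : Measure (Fin m → ℝ)}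
    (hμ : IsNDim μ n C₀) {a b : ℝ} (ha : 0 < a) (hb : 0 < b) (hab : b ≤ 3 * a) :
    annI μ n a b ≤ ENNReal.ofReal (C₀ * 6 ^ n) := by
  calc annI μ n a b
      ≤ ∫⁻ t in {t : Fin m → ℝ | a < ‖t‖ ∧ ‖t‖ ≤ b}, ENNReal.ofReal (a ^ (-n)) ∂μ := by
        refine setLIntegral_mono measurable_const ?_
        intro t ht
        exact ENNReal.ofReal_le_ofReal
          (Real.rpow_le_rpow_of_nonpos ha (le_of_lt ht.1) (by linarith))
    _ = ENNReal.ofReal (a ^ (-n)) * μ {t : Fin m → ℝ | a < ‖t‖ ∧ ‖t‖ ≤ b} := setLIntegral_const _ _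
    _ ≤ ENNReal.ofReal (a ^ (-n)) * ENNReal.ofReal (C₀ * (2 * b) ^ n) := by
        gcongr
        refine (measure_mono ?_).trans (ball_bound hμ 0 hb)
        intro t ht
        simpa using ht.2
    _ = ENNReal.ofReal (a ^ (-n) * (C₀ * (2 * b) ^ n)) :=
        (ENNReal.ofReal_mul (by positivity)).symm
    _ ≤ ENNReal.ofReal (C₀ * 6 ^ n) := by
        apply ENNReal.ofReal_le_ofReal
        calc a ^ (-n) * (C₀ * (2 * b) ^ n) ≤ a ^ (-n) * (C₀ * (6 * a) ^ n) := by
              gcongr ?_ * (?_ * ?_)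
              exact Real.rpow_le_rpow (by positivity) (by linarith) hn.le
          _ = C₀ * 6 ^ n := by
              rw [Real.mul_rpow (by norm_num) ha.le, Real.rpow_neg ha.le]
              have : a ^ n ≠ 0 := (Real.rpow_pos_of_pos ha n).ne'
              field_simp

lemma fubini_bound {m : ℕ} {n C₀ : ℝ} (hn : 0 < n) (hC₀ : 0 < C₀) {μ : Measure (Fin m → ℝ)}
    [IsFiniteMeasure μ] (hμ : IsNDim μ n C₀) (S : Set (Fin m → ℝ)) (b : ℝ) :
    ∫⁻ z in S, annI μ n ‖z‖ b ∂μ ≤ ENNReal.ofReal (C₀ * 2 ^ n) * μ (closedBall 0 b) := by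
  set D : Set ((Fin m → ℝ) × (Fin m → ℝ)) := {p | ‖p.1‖ < ‖p.2‖ ∧ ‖p.2‖ ≤ b} with hD
  have hDm : MeasurableSet D :=
    (measurableSet_lt measurable_fst.norm measurable_snd.norm).inter
      (measurableSet_le measurable_snd.norm measurable_const)
  set F : (Fin m → ℝ) → (Fin m → ℝ) → ENNReal := fun z t =>
    D.indicator (fun p => ENNReal.ofReal (‖p.2‖ ^ (-n))) (z, t) with hF
  have hFm : Measurable (Function.uncurry F) := by
    have : Measurable (D.indicator (fun p => ENNReal.ofReal (‖p.2‖ ^ (-n)))) :=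
      (measurable_snd.norm.pow_const _).ennreal_ofReal.indicator hDm
    exact this
  have h1 : ∀ z, annI μ n ‖z‖ b = ∫⁻ t, F z t ∂μ := by
    intro z
    unfold annI
    rw [← lintegral_indicator]
    · apply lintegral_congr
      intro t
      simp only [hF, hD, indicator, mem_setOf_eq]
    · exact (measurableSet_lt measurable_const measurable_norm).inter
        (measurableSet_le measurable_norm measurable_const)
  calc ∫⁻ z in S, annI μ n ‖z‖ b ∂μ ≤ ∫⁻ z, annI μ n ‖z‖ b ∂μ := setLIntegral_le_lintegral _ _
    _ = ∫⁻ z, ∫⁻ t, F z t ∂μ ∂μ := lintegral_congr h1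
    _ = ∫⁻ t, ∫⁻ z, F z t ∂μ ∂μ := lintegral_lintegral_swap hFm.aemeasurable
    _ ≤ ∫⁻ t, (closedBall (0 : Fin m → ℝ) b).indicator
          (fun _ => ENNReal.ofReal (C₀ * 2 ^ n)) t ∂μ := by
        apply lintegral_mono
        intro t
        change ∫⁻ z, F z t ∂μ ≤ _
        by_cases ht : ‖t‖ ≤ b
        · rw [indicator_of_mem (by simpa using ht)]
          rcases (norm_nonneg t).eq_or_lt with h0 | h0
          · have : ∀ z, F z t = 0 := by
              intro z
              apply indicator_of_notMem
              rintro ⟨h, _⟩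
              have := norm_nonneg z
              simp only at h
              linarith
            simp [this]
          · calc ∫⁻ z, F z t ∂μ ≤ ∫⁻ z, (closedBall (0 : Fin m → ℝ) ‖t‖).indicator
                    (fun _ => ENNReal.ofReal (‖t‖ ^ (-n))) z ∂μ := by
                  apply lintegral_mono
                  intro z
                  by_cases hz : (z, t) ∈ D
                  · have hz1 : z ∈ closedBall (0 : Fin m → ℝ) ‖t‖ := by
                      simpa using (le_of_lt hz.1)
                    simp only [hF, indicator_of_mem hz, indicator_of_mem hz1, le_refl]
                  · simp only [hF, indicator_of_notMem hz, zero_le]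
              _ = ENNReal.ofReal (‖t‖ ^ (-n)) * μ (closedBall 0 ‖t‖) := by
                  rw [lintegral_indicator isClosed_closedBall.measurableSet, setLIntegral_const]
              _ ≤ ENNReal.ofReal (‖t‖ ^ (-n)) * ENNReal.ofReal (C₀ * (2 * ‖t‖) ^ n) := by
                  gcongr
                  exact ball_bound hμ 0 h0
              _ = ENNReal.ofReal (C₀ * 2 ^ n) := by
                  rw [← ENNReal.ofReal_mul (by positivity)]
                  congr 1
                  rw [Real.mul_rpow (by norm_num) h0.le, Real.rpow_neg h0.le]
                  have : ‖t‖ ^ n ≠ 0 := (Real.rpow_pos_of_pos h0 n).ne'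
                  field_simp
        · have : ∀ z, F z t = 0 := by
            intro z
            apply indicator_of_notMem
            rintro ⟨_, h⟩
            exact ht h
          simp [this]
    _ = _ := by
        rw [lintegral_indicator isClosed_closedBall.measurableSet, setLIntegral_const]

/-- Pointwise domination of `|t|^{-n}` by a dyadic sum. -/
lemma dyadic_pt {m : ℕ} {n : ℝ} (hn : 0 < n) (x t : Fin m → ℝ) {l : ℝ} (hl : 0 < l) (M : ℕ)
    (hM : 1 ≤ M) (ht : ‖x‖ + l / 2 < ‖t‖) (htM : ‖t - x‖ ≤ 2 ^ M * l / 2) :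
    ENNReal.ofReal (‖t‖ ^ (-n)) ≤ ∑ j ∈ Finset.Icc 1 M,
      (cube x ((2 : ℝ) ^ j * l)).indicator
        (fun _ => ENNReal.ofReal (8 ^ n / ((2 : ℝ) ^ j * l) ^ n)) t := by
  classical
  have hx := norm_nonneg x
  have hex : ∃ j : ℕ, 1 ≤ j ∧ ‖t - x‖ ≤ 2 ^ j * l / 2 := ⟨M, hM, htM⟩
  set j := Nat.find hex with hj
  obtain ⟨hj1, hj2⟩ := Nat.find_spec hex
  rw [← hj] at hj1 hj2
  have hjM : j ≤ M := Nat.find_min' hex ⟨hM, htM⟩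
  have hmem : t ∈ cube x ((2 : ℝ) ^ j * l) := by
    unfold cube
    rw [mem_closedBall, dist_eq_norm]
    exact hj2
  have key : (2 : ℝ) ^ j * l / 8 ≤ ‖t‖ := by
    rcases hj1.eq_or_lt with h | h
    · rw [← h]
      linarith
    · have hlt : j - 1 < j := by omega
      have := Nat.find_min hex hlt
      have h3 : 2 ^ (j - 1) * l / 2 < ‖t - x‖ := by
        by_contra hc
        exact this ⟨by omega, not_lt.mp hc⟩
      have h4 : (2 : ℝ) ^ j = 2 * 2 ^ (j - 1) := by
        rw [← pow_succ']
        congr 1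
        omega
      have h5 := norm_sub_le t x
      rw [h4]
      linarith
  have hterm := Finset.single_le_sum (s := Finset.Icc 1 M)
    (f := fun j => (cube x ((2 : ℝ) ^ j * l)).indicator
        (fun _ => ENNReal.ofReal (8 ^ n / ((2 : ℝ) ^ j * l) ^ n)) t)
    (fun i _ => zero_le) (Finset.mem_Icc.mpr ⟨hj1, hjM⟩)
  refine le_trans ?_ hterm
  simp only [indicator_of_mem hmem]
  apply ENNReal.ofReal_le_ofReal
  have hp : 0 < (2 : ℝ) ^ j * l := by positivity
  calc ‖t‖ ^ (-n) ≤ (2 ^ j * l / 8) ^ (-n) :=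
        Real.rpow_le_rpow_of_nonpos (by positivity) key (by linarith)
    _ = 8 ^ n / ((2 : ℝ) ^ j * l) ^ n := by
        rw [Real.rpow_neg (by positivity), Real.div_rpow hp.le (by norm_num), inv_div]

lemma dyadic_bound {m : ℕ} {n C₀ : ℝ} (hn : 0 < n) (hC₀ : 0 < C₀) {μ : Measure (Fin m → ℝ)}
    [IsFiniteMeasure μ] (hμ : IsNDim μ n C₀) (x : Fin m → ℝ) {l l' b : ℝ} (hl : 0 < l)
    (hl' : 0 < l') (hx : ‖x‖ ≤ l') (hb : b ≤ 2 * l') :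
    annI μ n (‖x‖ + l / 2) b ≤ ENNReal.ofReal (8 ^ n * (1 + 3 * C₀) * Kcoef μ n x l l') := by
  set N := NQR l l' with hN
  have hNl : l' ≤ 2 ^ N * l := by
    have h1 : Real.logb 2 (l' / l) ≤ N := Nat.le_ceil _
    rw [Real.logb_le_iff_le_rpow (by norm_num) (by positivity), Real.rpow_natCast,
      div_le_iff₀ hl] at h1
    exact h1
  set T : ℕ → ℝ := fun j => (μ (cube x ((2 : ℝ) ^ j * l))).toReal / (((2 : ℝ) ^ j * l) ^ n) with hT
  have hT0 : ∀ j, 0 ≤ T j := fun j => by simp only [hT]; positivity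
  have hTC : ∀ j, T j ≤ C₀ := by
    intro j
    have hp : 0 < (2 : ℝ) ^ j * l := by positivity
    have h := hμ x _ hp
    have h2 := ENNReal.toReal_mono ENNReal.ofReal_ne_top h
    rw [ENNReal.toReal_ofReal (by positivity)] at h2
    simp only [hT]
    rw [div_le_iff₀ (by positivity)]
    exact h2
  have hK : Kcoef μ n x l l' = 1 + ∑ j ∈ Finset.Icc 1 N, T j := rfl
  have hcm : ∀ j : ℕ, MeasurableSet (cube x ((2 : ℝ) ^ j * l)) :=
    fun j => isClosed_closedBall.measurableSet
  calc annI μ n (‖x‖ + l / 2) b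
      ≤ ∫⁻ t in {t : Fin m → ℝ | ‖x‖ + l / 2 < ‖t‖ ∧ ‖t‖ ≤ b},
          ∑ j ∈ Finset.Icc 1 (N + 3), (cube x ((2 : ℝ) ^ j * l)).indicator
            (fun _ => ENNReal.ofReal (8 ^ n / ((2 : ℝ) ^ j * l) ^ n)) t ∂μ := by
        refine setLIntegral_mono
          (Finset.measurable_fun_sum _ fun j _ => measurable_const.indicator (hcm j)) ?_
        intro t ht
        apply dyadic_pt hn x t hl (N + 3) (by omega) ht.1
        have h5 := norm_sub_le t x
        have h6 := ht.2
        rw [pow_add]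
        linarith
    _ ≤ ∫⁻ t, ∑ j ∈ Finset.Icc 1 (N + 3), (cube x ((2 : ℝ) ^ j * l)).indicator
            (fun _ => ENNReal.ofReal (8 ^ n / ((2 : ℝ) ^ j * l) ^ n)) t ∂μ :=
        setLIntegral_le_lintegral _ _
    _ = ∑ j ∈ Finset.Icc 1 (N + 3), ENNReal.ofReal (8 ^ n * T j) := by
        rw [lintegral_finsetSum _ fun j _ => measurable_const.indicator (hcm j)]
        apply Finset.sum_congr rfl
        intro j _
        rw [lintegral_indicator (hcm j), setLIntegral_const]
        conv_lhs => rw [← ENNReal.ofReal_toReal (measure_ne_top μ (cube x ((2 : ℝ) ^ j * l)))]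
        rw [← ENNReal.ofReal_mul (by positivity)]
        congr 1
        simp only [hT]
        ring
    _ = ENNReal.ofReal (∑ j ∈ Finset.Icc 1 (N + 3), 8 ^ n * T j) :=
        (ENNReal.ofReal_sum_of_nonneg fun j _ => mul_nonneg (by positivity) (hT0 j)).symm
    _ ≤ _ := by
        apply ENNReal.ofReal_le_ofReal
        rw [← Finset.mul_sum, mul_assoc, hK]
        gcongr
        rw [Finset.sum_Icc_succ_top (by omega), Finset.sum_Icc_succ_top (by omega),
          Finset.sum_Icc_succ_top (by omega)]
        have hs : 0 ≤ ∑ j ∈ Finset.Icc 1 N, T j := Finset.sum_nonneg fun j _ => hT0 j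
        have := hTC (N + 1)
        have := hTC (N + 2)
        have := hTC (N + 3)
        have h9 : 0 ≤ C₀ * ∑ j ∈ Finset.Icc 1 N, T j := mul_nonneg hC₀.le hs
        nlinarith

lemma cube_subset {m : ℕ} (hm : 0 < m) {x y : Fin m → ℝ} {l l' : ℝ} (hl : 0 < l)
    (h : cube x l ⊆ cube y l') : ‖x - y‖ + l / 2 ≤ l' / 2 := by
  haveI : Nonempty (Fin m) := ⟨⟨0, hm⟩⟩
  unfold cube at h
  obtain ⟨i, hi⟩ : ∃ i, ‖x - y‖ = ‖(x - y) i‖ := by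
    obtain ⟨i, _, hi⟩ := Finset.exists_mem_eq_sup' Finset.univ_nonempty (fun i => ‖(x - y) i‖)
    refine ⟨i, le_antisymm ?_ (norm_le_pi_norm _ i)⟩
    refine (pi_norm_le_iff_of_nonneg (norm_nonneg _)).mpr fun k => ?_
    rw [← hi]
    exact Finset.le_sup' (fun i => ‖(x - y) i‖) (Finset.mem_univ k)
  rw [Real.norm_eq_abs] at hi
  have aux : ∀ e : ℝ, |e| ≤ l / 2 → |(x - y) i + e| ≤ l' / 2 := by
    intro e he
    have h1 : (x + fun _ => e) ∈ closedBall x (l / 2) := by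
      rw [mem_closedBall, dist_eq_norm, add_sub_cancel_left]
      exact (pi_norm_le_iff_of_nonneg (by linarith)).mpr fun _ => he
    have h2 := h h1
    rw [mem_closedBall, dist_eq_norm] at h2
    have h3 := (norm_le_pi_norm _ i).trans h2
    rw [Real.norm_eq_abs] at h3
    simp only [Pi.sub_apply, Pi.add_apply] at h3 ⊢
    rwa [show x i - y i + e = x i + e - y i by ring]
  rw [hi]
  rcases abs_cases ((x - y) i) with ⟨h1, _⟩ | ⟨h1, _⟩
  · have := (abs_le.mp (aux (l / 2) (by rw [abs_of_pos (by linarith)]))).2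
    linarith
  · have := (abs_le.mp (aux (-(l / 2)) (by rw [abs_neg, abs_of_pos (by linarith)]))).1
    linarith

theorem stmt17 {m : ℕ} (n C₀ : ℝ) (hn : 0 < n) (hnm : n ≤ m)
    (μ : Measure (Fin m → ℝ)) [IsFiniteMeasure μ]
    (hC₀ : 0 < C₀) (hμ : IsNDim μ n C₀) :
    ∃ C : ℝ, 0 < C ∧ ∀ (xQ : Fin m → ℝ) (ℓQ : ℝ) (yQ : Fin m → ℝ),
      0 < ℓQ → ‖yQ‖ = ‖xQ‖ + ℓQ / 2 →
      ((∫ z in cube xQ ℓQ, |phi μ n z - phi μ n yQ| ∂μ) ≤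
        C * (μ (cube xQ (5 * ℓQ))).toReal) ∧
      (∀ (xR : Fin m → ℝ) (ℓR : ℝ) (yR : Fin m → ℝ), 0 < ℓR →
        cube xQ ℓQ ⊆ cube xR ℓR → ‖yR‖ = ‖xR‖ + ℓR / 2 →
        |phi μ n yQ - phi μ n yR| ≤ C * Kcoef μ n xQ ℓQ ℓR) := by
  have hm : 0 < m := by
    have : (0:ℝ) < m := lt_of_lt_of_le hn hnm
    exact_mod_cast this
  have p68 : (6:ℝ) ^ n ≤ 8 ^ n := Real.rpow_le_rpow (by norm_num) (by norm_num) hn.le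
  have p28 : (2:ℝ) ^ n ≤ 8 ^ n := Real.rpow_le_rpow (by norm_num) (by norm_num) hn.le
  have p8 : (0:ℝ) < 8 ^ n := by positivity
  set C : ℝ := 8 ^ n * (1 + 3 * C₀) with hC
  have hCpos : 0 < C := by positivity
  have c6 : C₀ * 6 ^ n ≤ C := by
    have := mul_le_mul_of_nonneg_left p68 hC₀.le
    have : 0 < C₀ * 8 ^ n := by positivity
    rw [hC]; nlinarith
  have c2 : C₀ * 2 ^ n ≤ C := by
    have := mul_le_mul_of_nonneg_left p28 hC₀.le
    have : 0 < C₀ * 8 ^ n := by positivity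
    rw [hC]; nlinarith
  refine ⟨C, hCpos, ?_⟩
  intro xQ l yQ hl hy
  have hx0 := norm_nonneg xQ
  have hsub5 : ∀ r : ℝ, cube xQ l ⊆ cube xQ (5 * l) := fun _ =>
    closedBall_subset_closedBall (by linarith)
  constructor
  · have hmain : ∫⁻ z in cube xQ l, ENNReal.ofReal |phi μ n z - phi μ n yQ| ∂μ ≤
        ENNReal.ofReal C * μ (cube xQ (5 * l)) := by
      have hzn : ∀ z ∈ cube xQ l, ‖z‖ ≤ ‖yQ‖ ∧ ‖xQ‖ - l / 2 ≤ ‖z‖ := by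
        intro z hz
        unfold cube at hz
        rw [mem_closedBall, dist_eq_norm] at hz
        have h1 := norm_sub_norm_le z xQ
        have h2 := norm_sub_norm_le xQ z
        rw [norm_sub_rev] at h2
        constructor <;> linarith
      have hQm : MeasurableSet (cube xQ l) := isClosed_closedBall.measurableSet
      rcases le_or_gt l ‖xQ‖ with hcase | hcase
      · calc ∫⁻ z in cube xQ l, ENNReal.ofReal |phi μ n z - phi μ n yQ| ∂μ
            ≤ ∫⁻ z in cube xQ l, ENNReal.ofReal C ∂μ := by
              refine setLIntegral_mono measurable_const ?_
              intro z hz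
              obtain ⟨h1, h2⟩ := hzn z hz
              have hz0 : 0 < ‖z‖ := by linarith
              rw [phi_diff hn μ hz0 h1]
              exact (annI_bound hn hC₀ hμ hz0 (by linarith) (by linarith)).trans
                (ENNReal.ofReal_le_ofReal c6)
          _ = ENNReal.ofReal C * μ (cube xQ l) := setLIntegral_const _ _
          _ ≤ _ := by
              gcongr
              exact hsub5 0
      · have hae : ∀ᵐ z ∂(μ.restrict (cube xQ l)),
            ENNReal.ofReal |phi μ n z - phi μ n yQ| ≤ annI μ n ‖z‖ ‖yQ‖ := by
          rw [ae_restrict_iff' hQm]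
          have h0 : ∀ᵐ z ∂μ, z ≠ 0 := by
            rw [ae_iff]
            simpa using zero_null hn hμ
          filter_upwards [h0] with z hz hzQ
          exact (phi_diff hn μ (norm_pos_iff.mpr hz) (hzn z hzQ).1).le
        calc ∫⁻ z in cube xQ l, ENNReal.ofReal |phi μ n z - phi μ n yQ| ∂μ
            ≤ ∫⁻ z in cube xQ l, annI μ n ‖z‖ ‖yQ‖ ∂μ := lintegral_mono_ae hae
          _ ≤ ENNReal.ofReal (C₀ * 2 ^ n) * μ (closedBall 0 ‖yQ‖) :=
              fubini_bound hn hC₀ hμ _ _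
          _ ≤ _ := by
              gcongr
              unfold cube
              apply closedBall_subset_closedBall'
              rw [dist_comm, dist_zero_right]
              linarith
    have h1 := norm_integral_le_lintegral_norm (μ := μ.restrict (cube xQ l))
      (fun z => |phi μ n z - phi μ n yQ|)
    simp only [Real.norm_eq_abs, abs_abs] at h1
    refine (le_abs_self _).trans (h1.trans ?_)
    have h2 := ENNReal.toReal_mono
      (ENNReal.mul_ne_top ENNReal.ofReal_ne_top (measure_ne_top μ _)) hmain
    rwa [ENNReal.toReal_mul, ENNReal.toReal_ofReal hCpos.le] at h2
  · intro xR lR yR hlR hQR hyR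
    have hs := cube_subset hm hl hQR
    have h1 := norm_sub_norm_le xQ xR
    have h2 := norm_sub_norm_le xR xQ
    rw [norm_sub_rev] at h2
    have hyQ0 : 0 < ‖yQ‖ := by linarith
    have hyy : ‖yQ‖ ≤ ‖yR‖ := by linarith
    have hK1 : 1 ≤ Kcoef μ n xQ l lR := by
      unfold Kcoef
      have : 0 ≤ ∑ j ∈ Finset.Icc 1 (NQR l lR),
          (μ (cube xQ ((2 : ℝ) ^ j * l))).toReal / (((2 : ℝ) ^ j * l) ^ n) :=
        Finset.sum_nonneg fun j _ => by positivity
      linarith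
    rw [← ENNReal.ofReal_le_ofReal_iff (by positivity), phi_diff hn μ hyQ0 hyy]
    rcases le_or_gt lR ‖xQ‖ with hcase | hcase
    · refine (annI_bound hn hC₀ hμ hyQ0 (by linarith) (by linarith)).trans
        (ENNReal.ofReal_le_ofReal ?_)
      nlinarith
    · rw [hy]
      exact dyadic_bound hn hC₀ hμ xQ hl hlR hcase.le (by linarith)
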